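/- Let φ: X → G be a central Γ-equivariant extension of a Γ-perfect Γ-group G, and let X' = [X,X]_Γ be the Γ-commutator subgroup of X. Then the restriction φ|_{X'}: X' → G is again a central Γ-equivariant extension of G; in particular there exists a Γ-equivariant function γ': G → X' with φ∘γ' = id_G. -/

import Mathlib

/-- The Γ-commutator subgroup `[G,G]_Γ` of a Γ-group `G`: the subgroup generated by all
commutators together with the elements `(σ • g) * g⁻¹`. -/
def gammaCommutator (Γ G : Type*) [Group Γ] [Group G] [MulDistribMulAction Γ G] : Subgroup G :=
  Subgroup.closure ({x | ∃ a b : G, x = a * b * a⁻¹ * b⁻¹} ∪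
    {x | ∃ (σ : Γ) (g : G), x = σ • g * g⁻¹})

instance gammaCommutator_normal (Γ G : Type*) [Group Γ] [Group G] [MulDistribMulAction Γ G] :
    (gammaCommutator Γ G).Normal := by
  constructor
  intro n hn g
  have h1 : g * n * g⁻¹ * n⁻¹ ∈ gammaCommutator Γ G :=
    Subgroup.subset_closure (Or.inl ⟨g, n, rfl⟩)
  have h2 := mul_mem h1 hn
  simpa [mul_assoc] using h2

theorem gammaCommutator_smul_mem {Γ G : Type*} [Group Γ] [Group G] [MulDistribMulAction Γ G]
    (σ : Γ) {x : G} (hx : x ∈ gammaCommutator Γ G) : σ • x ∈ gammaCommutator Γ G := by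
  induction hx using Subgroup.closure_induction with
  | mem y hy =>
    rcases hy with ⟨a, b, rfl⟩ | ⟨τ, g, rfl⟩
    · refine Subgroup.subset_closure (Or.inl ⟨σ • a, σ • b, ?_⟩)
      simp [smul_mul', smul_inv']
    · refine Subgroup.subset_closure (Or.inr ⟨σ * τ * σ⁻¹, σ • g, ?_⟩)
      rw [smul_mul', smul_inv', ← mul_smul, ← mul_smul]
      simp [mul_assoc]
  | one => simpa using one_mem (gammaCommutator Γ G)
  | mul a b _ _ iha ihb => rw [smul_mul']; exact mul_mem iha ihb
  | inv a _ iha => rw [smul_inv']; exact inv_mem iha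

instance gammaCommutatorAction (Γ G : Type*) [Group Γ] [Group G] [MulDistribMulAction Γ G] :
    MulDistribMulAction Γ (gammaCommutator Γ G) where
  smul σ x := ⟨σ • (x : G), gammaCommutator_smul_mem σ x.2⟩
  one_smul x := Subtype.ext (one_smul Γ (x : G))
  mul_smul σ τ x := Subtype.ext (mul_smul σ τ (x : G))
  smul_mul σ x y := Subtype.ext (smul_mul' σ (x : G) (y : G))
  smul_one σ := Subtype.ext (smul_one σ)

instance gammaAbelianization_commGroup (Γ G : Type*) [Group Γ] [Group G]
    [MulDistribMulAction Γ G] : CommGroup (G ⧸ gammaCommutator Γ G) where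
  mul_comm a b := by
    induction a using QuotientGroup.induction_on with
    | _ x =>
    induction b using QuotientGroup.induction_on with
    | _ y =>
    rw [← QuotientGroup.mk_mul, ← QuotientGroup.mk_mul, QuotientGroup.eq]
    exact Subgroup.subset_closure (Or.inl ⟨y⁻¹, x⁻¹, by group⟩)

universe u v

/-- `φ : B →* G` is a central Γ-equivariant extension of the Γ-group `G`. -/
def IsCentralGammaExt (Γ : Type u) [Group Γ] {B G : Type v} [Group B] [Group G]
    [MulDistribMulAction Γ B] [MulDistribMulAction Γ G] (φ : B →* G) : Prop :=
  (∀ (σ : Γ) (b : B), φ (σ • b) = σ • φ b) ∧ Function.Surjective φ ∧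
    φ.ker ≤ Subgroup.center B ∧ (∀ (σ : Γ), ∀ b ∈ φ.ker, σ • b = b) ∧
    ∃ γ : G → B, (∀ (σ : Γ) (g : G), γ (σ • g) = σ • γ g) ∧ ∀ g, φ (γ g) = g

/-- A central Γ-equivariant extension `β : U →* G` is universal if for every central
Γ-equivariant extension `α : X →* G` there is a unique Γ-homomorphism `U →* X` over `G`. -/
def IsUniversalCentralGammaExt (Γ : Type u) [Group Γ] {U G : Type v} [Group U] [Group G]
    [MulDistribMulAction Γ U] [MulDistribMulAction Γ G] (β : U →* G) : Prop :=
  IsCentralGammaExt Γ β ∧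
    ∀ (X : Type v) [Group X] [MulDistribMulAction Γ X] (α : X →* G),
      IsCentralGammaExt Γ α →
        ∃! f : U →* X, (∀ (σ : Γ) (u : U), f (σ • u) = σ • f u) ∧ α.comp f = β

theorem map_gammaCommutator_of_surjective {Γ X G : Type*} [Group Γ] [Group X] [Group G]
    [MulDistribMulAction Γ X] [MulDistribMulAction Γ G] (φ : X →* G)
    (hφ : ∀ (σ : Γ) (x : X), φ (σ • x) = σ • φ x) (hsurj : Function.Surjective φ) :
    (gammaCommutator Γ X).map φ = gammaCommutator Γ G := by
  refine le_antisymm ?_ ?_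
  · rw [Subgroup.map_le_iff_le_comap]
    refine (Subgroup.closure_le _).2 ?_
    rintro _ (⟨a, b, rfl⟩ | ⟨σ, a, rfl⟩)
    · exact Subgroup.subset_closure (Or.inl ⟨φ a, φ b, by simp⟩)
    · exact Subgroup.subset_closure (Or.inr ⟨σ, φ a, by simp [hφ]⟩)
  · refine (Subgroup.closure_le _).2 ?_
    rintro _ (⟨a, b, rfl⟩ | ⟨σ, a, rfl⟩)
    · obtain ⟨x, rfl⟩ := hsurj a
      obtain ⟨y, rfl⟩ := hsurj b
      exact ⟨_, Subgroup.subset_closure (Or.inl ⟨x, y, rfl⟩), by simp⟩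
    · obtain ⟨x, rfl⟩ := hsurj a
      exact ⟨_, Subgroup.subset_closure (Or.inr ⟨σ, x, rfl⟩), by simp [hφ]⟩

theorem mk_smul_gammaCommutator {Γ X : Type*} [Group Γ] [Group X] [MulDistribMulAction Γ X]
    (σ : Γ) (x : X) : ((σ • x : X) : X ⧸ gammaCommutator Γ X) = x := by
  rw [QuotientGroup.eq_iff_div_mem, div_eq_mul_inv]
  exact Subgroup.subset_closure (Or.inr ⟨σ, x, rfl⟩)

/-- If `φ : X →* G` is a central Γ-equivariant extension of a Γ-perfect
Γ-group `G`, then the restriction of `φ` to the Γ-commutator subgroup `X' = [X,X]_Γ`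
(with its induced Γ-action) is again a central Γ-equivariant extension of `G`; in
particular there is a Γ-equivariant section `γ' : G → X'` of `φ|_{X'}`. -/
theorem restriction_to_gammaCommutator_isCentralGammaExt {Γ : Type u} [Group Γ]
    {X G : Type v} [Group X] [Group G] [MulDistribMulAction Γ X] [MulDistribMulAction Γ G]
    (φ : X →* G) (hφ : IsCentralGammaExt Γ φ) (hG : gammaCommutator Γ G = ⊤) :
    IsCentralGammaExt Γ (φ.comp (gammaCommutator Γ X).subtype) ∧
      ∃ γ' : G → gammaCommutator Γ X,
        (∀ (σ : Γ) (g : G), γ' (σ • g) = σ • γ' g) ∧ ∀ g : G, φ (γ' g) = g := by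
  obtain ⟨hequiv, hsurj, hcentral, hfix, γ, hγ, hγφ⟩ := hφ
  have hlift (g : G) : ∃ y ∈ gammaCommutator Γ X, φ y = g := by
    rw [← Subgroup.mem_map, map_gammaCommutator_of_surjective φ hequiv hsurj, hG]
    exact Subgroup.mem_top g
  have hker (q : X ⧸ gammaCommutator Γ X) :
      ∃ k ∈ φ.ker, q * (k : X ⧸ gammaCommutator Γ X) = 1 := by
    induction q using QuotientGroup.induction_on with
    | _ x =>
    obtain ⟨y, hy, hyx⟩ := hlift (φ x)
    refine ⟨x⁻¹ * y, by simp [MonoidHom.mem_ker, hyx], ?_⟩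
    rw [← QuotientGroup.mk_mul, mul_inv_cancel_left]
    exact (QuotientGroup.eq_one_iff y).2 hy
  -- A correction term depending only on the class modulo `[X,X]_Γ` is constant on Γ-orbits.
  choose k hk hqk using hker
  have hsection : ∃ γ' : G → gammaCommutator Γ X,
      (∀ (σ : Γ) (g : G), γ' (σ • g) = σ • γ' g) ∧ ∀ g : G, φ (γ' g) = g := by
    refine ⟨fun g => ⟨γ g * k (γ g), (QuotientGroup.eq_one_iff _).1 (hqk (γ g))⟩,
      fun σ g => Subtype.ext ?_, fun g => ?_⟩
    · change γ (σ • g) * k (γ (σ • g)) = σ • (γ g * k (γ g))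
      rw [hγ, mk_smul_gammaCommutator, smul_mul', hfix σ _ (hk _)]
    · change φ (γ g * k (γ g)) = g
      rw [map_mul, hγφ, MonoidHom.mem_ker.1 (hk _), mul_one]
  refine ⟨⟨fun σ x => hequiv σ x, fun g => ?_, fun x hx => ?_, fun σ x hx => ?_, hsection⟩,
    hsection⟩
  · obtain ⟨y, hy, hyg⟩ := hlift g
    exact ⟨⟨y, hy⟩, hyg⟩
  · exact Subgroup.mem_center_iff.2 fun y =>
      Subtype.ext (Subgroup.mem_center_iff.1 (hcentral hx) y)
  · exact Subtype.ext (hfix σ x hx)
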